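/- arXiv:1810.08345 — 3 statements merged into one kernel-verified Lean document; each statement's English description precedes it below -/
import Mathlib

section
/- There exist absolute constants C > 0 and c > 0 such that the following holds. Let G be a connected unweighted graph on n ≥ 2 vertices in which every edge has leverage score at most ε̄, where the leverage score of an edge e is the probability that e belongs to a uniform random spanning tree of G. Then a uniform random spanning tree T of G satisfies Σ_{e∈T} b_e b_eᵀ ⪯ C·ε̄·(ln n)·L_G with probability at least 1 − n^{−c}. -/
open Matrix Finset
attribute [local instance] Classical.propDecidable

noncomputable section

/-- Spectral norm expressed as the supremum of |xᵀAx| over unit vectors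
(this agrees with the operator norm for symmetric matrices). -/
def specNorm {n : ℕ} (A : Matrix (Fin n) (Fin n) ℝ) : ℝ :=
  sSup { r | ∃ x : Fin n → ℝ, x ⬝ᵥ x = 1 ∧ |x ⬝ᵥ A.mulVec x| = r }

/-- A distribution on {0,1}^m is k-homogeneous if every support vector has exactly k ones. -/
def kHomogeneous (m k : ℕ) (π : (Fin m → Bool) → ℝ) : Prop :=
  ∀ ξ, π ξ ≠ 0 → (Finset.univ.filter fun i => ξ i = true).card = k

/-- A distribution on {0,1}^m is Strongly Rayleigh if its generating polynomial
has no root with all coordinates of positive imaginary part. -/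
def StronglyRayleigh (m : ℕ) (π : (Fin m → Bool) → ℝ) : Prop :=
  ∀ z : Fin m → ℂ, (∀ i, 0 < (z i).im) →
    (∑ ξ : Fin m → Bool, (π ξ : ℂ) * ∏ i ∈ Finset.univ.filter (fun i => ξ i = true), z i) ≠ 0

/-- The rank-one matrix b_e b_eᵀ for an edge e = {u,v}, where b_e = 1_u - 1_v. -/
def edgeMat (n : ℕ) (e : Sym2 (Fin n)) : Matrix (Fin n) (Fin n) ℝ :=
  fun i j => (if i = j ∧ i ∈ e then 1 else 0) + (if i ≠ j ∧ i ∈ e ∧ j ∈ e then -1 else 0)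

/-- Weighted graph Laplacian. -/
def lap (n : ℕ) (G : SimpleGraph (Fin n)) (w : Sym2 (Fin n) → ℝ) : Matrix (Fin n) (Fin n) ℝ :=
  ∑ e : Sym2 (Fin n), (if e ∈ G.edgeSet then w e else 0) • edgeMat n e

/-- T is a spanning tree of G: its edges lie in G, it is (spanning) connected,
and it has n - 1 edges. -/
def IsSpanningTree (n : ℕ) (G : SimpleGraph (Fin n)) (T : Finset (Sym2 (Fin n))) : Prop :=
  ↑T ⊆ G.edgeSet ∧ (SimpleGraph.fromEdgeSet (↑T : Set (Sym2 (Fin n)))).Connected ∧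
    T.card = n - 1

/-- Product of edge weights of a tree. -/
def treeWt (n : ℕ) (w : Sym2 (Fin n) → ℝ) (T : Finset (Sym2 (Fin n))) : ℝ := ∏ e ∈ T, w e

/-- w-uniform spanning tree distribution: Pr[T] ∝ ∏_{e ∈ T} w_e. -/
def treeProb (n : ℕ) (G : SimpleGraph (Fin n)) (w : Sym2 (Fin n) → ℝ)
    (T : Finset (Sym2 (Fin n))) : ℝ :=
  (if IsSpanningTree n G T then treeWt n w T else 0) /
    ∑ T' ∈ Finset.univ.filter (fun T' => IsSpanningTree n G T'), treeWt n w T'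

/-- Leverage score of an edge: marginal probability of appearing in the random spanning tree. -/
def lev (n : ℕ) (G : SimpleGraph (Fin n)) (w : Sym2 (Fin n) → ℝ) (e : Sym2 (Fin n)) : ℝ :=
  ∑ T ∈ Finset.univ.filter (fun T => IsSpanningTree n G T ∧ e ∈ T), treeProb n G w T

/-- Inverse-leverage-score-weighted Laplacian of a tree. -/
def treeLap (n : ℕ) (G : SimpleGraph (Fin n)) (w : Sym2 (Fin n) → ℝ)
    (T : Finset (Sym2 (Fin n))) : Matrix (Fin n) (Fin n) ℝ :=
  ∑ e ∈ T, (w e / lev n G w e) • edgeMat n e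



namespace RST

/-- Spectral representation of all the quadratic forms and traces we need. -/
lemma spec_rep {ι : Type*} [Fintype ι] [DecidableEq ι] (M : Matrix ι ι ℝ) (hM : M.PosSemidef) :
    ∃ (lam : ι → ℝ) (U : Matrix ι ι ℝ), (∀ k, 0 ≤ lam k) ∧ Uᵀ * U = 1 ∧ U * Uᵀ = 1 ∧
      ∀ (R : ℝ) (i b : ℕ), M ^ i * (M + R • (1 : Matrix ι ι ℝ)) ^ b =
        U * diagonal (fun k => lam k ^ i * (lam k + R) ^ b) * Uᵀ := by
  have hH := hM.1
  let U : Matrix ι ι ℝ := (hH.eigenvectorUnitary : Matrix ι ι ℝ)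
  have h1 : Uᵀ * U = 1 := by
    have := Unitary.coe_star_mul_self hH.eigenvectorUnitary
    simpa [star_eq_conjTranspose, U] using this
  have h2 : U * Uᵀ = 1 := mul_eq_one_comm.mp h1
  have hsp : M = U * diagonal hH.eigenvalues * Uᵀ := by
    have := hH.spectral_theorem
    simpa [Unitary.conjStarAlgAut_apply, star_eq_conjTranspose, U] using this
  have hmul : ∀ f g : ι → ℝ, (U * diagonal f * Uᵀ) * (U * diagonal g * Uᵀ) =
      U * diagonal (fun k => f k * g k) * Uᵀ := by
    intro f g
    calc (U * diagonal f * Uᵀ) * (U * diagonal g * Uᵀ)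
        = U * diagonal f * (Uᵀ * U) * diagonal g * Uᵀ := by simp only [Matrix.mul_assoc]
      _ = U * (diagonal f * diagonal g) * Uᵀ := by rw [h1, Matrix.mul_one]; simp only [Matrix.mul_assoc]
      _ = _ := by rw [diagonal_mul_diagonal]
  have hone : (1 : Matrix ι ι ℝ) = U * diagonal (fun _ => 1) * Uᵀ := by simp [h2]
  have hpow : ∀ (f : ι → ℝ) (i : ℕ), (U * diagonal f * Uᵀ) ^ i =
      U * diagonal (fun k => f k ^ i) * Uᵀ := by
    intro f i
    induction i with
    | zero => simpa using hone
    | succ i ih => rw [pow_succ, ih, hmul]; simp only [pow_succ]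
  refine ⟨hH.eigenvalues, U, hM.eigenvalues_nonneg, h1, h2, ?_⟩
  intro R i b
  have hR : M + R • (1 : Matrix ι ι ℝ) = U * diagonal (fun k => hH.eigenvalues k + R) * Uᵀ := by
    have : diagonal (fun k => hH.eigenvalues k + R) = diagonal hH.eigenvalues + R • (1 : Matrix ι ι ℝ) := by
      ext a c; by_cases h : a = c <;> simp [diagonal, h]
    rw [this, Matrix.mul_add, Matrix.add_mul, ← hsp]
    simp [h2]
  rw [hR, hpow]
  have hi : M ^ i = U * diagonal (fun k => hH.eigenvalues k ^ i) * Uᵀ := by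
    rw [← hpow, ← hsp]
  rw [hi, hmul]

lemma quad_diag {ι : Type*} [Fintype ι] [DecidableEq ι] (U : Matrix ι ι ℝ) (f : ι → ℝ)
    (v : ι → ℝ) : v ⬝ᵥ ((U * diagonal f * Uᵀ) *ᵥ v) = ∑ k, (Uᵀ *ᵥ v) k ^ 2 * f k := by
  rw [← mulVec_mulVec, ← mulVec_mulVec, dotProduct_mulVec, ← mulVec_transpose]
  simp only [dotProduct, mulVec_diagonal]
  exact Finset.sum_congr rfl fun k _ => by ring

lemma quad_one {ι : Type*} [Fintype ι] [DecidableEq ι] (U : Matrix ι ι ℝ) (h : U * Uᵀ = 1)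
    (v : ι → ℝ) : v ⬝ᵥ v = ∑ k, (Uᵀ *ᵥ v) k ^ 2 := by
  have := quad_diag U (fun _ => 1) v
  simpa [h] using this

lemma cheb {ι : Type*} [Fintype ι] (w f g : ι → ℝ) (hw : ∀ k, 0 ≤ w k)
    (hfg : ∀ k l, 0 ≤ (f k - f l) * (g k - g l)) :
    (∑ k, w k * f k) * (∑ k, w k * g k) ≤ (∑ k, w k) * ∑ k, w k * (f k * g k) := by
  have h : 0 ≤ ∑ k, ∑ l, w k * w l * ((f k - f l) * (g k - g l)) :=
    Finset.sum_nonneg fun k _ => Finset.sum_nonneg fun l _ =>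
      mul_nonneg (mul_nonneg (hw k) (hw l)) (hfg k l)
  have e : ∑ k, ∑ l, w k * w l * ((f k - f l) * (g k - g l)) =
      2 * ((∑ k, w k) * ∑ k, w k * (f k * g k)) - 2 * ((∑ k, w k * f k) * (∑ k, w k * g k)) := by
    have e1 : ∑ k, ∑ l, w k * w l * ((f k - f l) * (g k - g l)) =
      ∑ k, ∑ l, ((w k * (f k * g k)) * w l + w k * (w l * (f l * g l)) - (w k * f k) * (w l * g l)
        - (w k * g k) * (w l * f l)) :=
      Finset.sum_congr rfl fun k _ => Finset.sum_congr rfl fun l _ => by ring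
    rw [e1]
    simp only [Finset.sum_add_distrib, Finset.sum_sub_distrib, ← Finset.sum_mul_sum]
    ring
  linarith

/-- The mixed quadratic form bound. -/
lemma S_facts {ι : Type*} [Fintype ι] [DecidableEq ι] (M : Matrix ι ι ℝ) (hM : M.PosSemidef)
    (v : ι → ℝ) (R : ℝ) (hR : v ⬝ᵥ v ≤ R) (i b : ℕ) :
    0 ≤ v ⬝ᵥ ((M ^ i * (M + R • (1 : Matrix ι ι ℝ)) ^ b) *ᵥ v) ∧
    (v ⬝ᵥ (M ^ i *ᵥ v)) * (v ⬝ᵥ ((M + R • (1 : Matrix ι ι ℝ)) ^ b *ᵥ v)) ≤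
      R * (v ⬝ᵥ ((M ^ i * (M + R • (1 : Matrix ι ι ℝ)) ^ b) *ᵥ v)) := by
  obtain ⟨lam, U, h0, h1, h2, h3⟩ := spec_rep M hM
  have hvv : 0 ≤ v ⬝ᵥ v := by
    rw [quad_one U h2]; positivity
  have hR0 : 0 ≤ R := hvv.trans hR
  have hS : 0 ≤ v ⬝ᵥ ((M ^ i * (M + R • (1 : Matrix ι ι ℝ)) ^ b) *ᵥ v) := by
    rw [h3, quad_diag]
    exact Finset.sum_nonneg fun k _ => by have := h0 k; positivity
  refine ⟨hS, ?_⟩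
  refine le_trans ?_ (mul_le_mul_of_nonneg_right hR hS)
  have e1 := h3 R i 0
  have e2 := h3 R 0 b
  simp only [pow_zero, mul_one, one_mul] at e1 e2
  rw [h3, e1, e2, quad_diag, quad_diag, quad_diag, quad_one U h2 v]
  refine cheb (fun k => (Uᵀ *ᵥ v) k ^ 2) (fun k => lam k ^ i) (fun k => (lam k + R) ^ b)
    (fun k => sq_nonneg _) ?_
  intro k l
  rcases le_total (lam k) (lam l) with h | h
  · refine mul_nonneg_of_nonpos_of_nonpos (sub_nonpos.2 ?_) (sub_nonpos.2 ?_)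
    · exact pow_le_pow_left₀ (h0 k) h i
    · exact pow_le_pow_left₀ (add_nonneg (h0 k) hR0) (by linarith) b
  · refine mul_nonneg (sub_nonneg.2 ?_) (sub_nonneg.2 ?_)
    · exact pow_le_pow_left₀ (h0 l) h i
    · exact pow_le_pow_left₀ (add_nonneg (h0 l) hR0) (by linarith) b

lemma z_le {ι : Type*} [Fintype ι] [DecidableEq ι] (M : Matrix ι ι ℝ) (hM : M.PosSemidef)
    (v : ι → ℝ) (R : ℝ) (hR : v ⬝ᵥ v ≤ R) (b : ℕ) : ∀ i : ℕ,
    v ⬝ᵥ ((M ^ i * (M + vecMulVec v v) ^ b) *ᵥ v) ≤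
      v ⬝ᵥ ((M ^ i * (M + R • (1 : Matrix ι ι ℝ)) ^ b) *ᵥ v) := by
  induction b with
  | zero => intro i; simp
  | succ b ih =>
    intro i
    have e1 : v ⬝ᵥ ((M ^ i * (M + vecMulVec v v) ^ (b+1)) *ᵥ v) =
        v ⬝ᵥ ((M ^ (i+1) * (M + vecMulVec v v) ^ b) *ᵥ v) +
        (v ⬝ᵥ (M ^ i *ᵥ v)) * (v ⬝ᵥ ((M ^ 0 * (M + vecMulVec v v) ^ b) *ᵥ v)) := by
      rw [pow_succ', Matrix.add_mul, Matrix.mul_add, Matrix.add_mulVec, dotProduct_add, pow_succ,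
        Matrix.mul_assoc]
      congr 1
      rw [← mulVec_mulVec, ← mulVec_mulVec, vecMulVec_mulVec, pow_zero, one_mul]
      simp [mulVec_smul, dotProduct_smul, mul_comm]
    have e2 : v ⬝ᵥ ((M ^ i * (M + R • (1 : Matrix ι ι ℝ)) ^ (b+1)) *ᵥ v) =
        v ⬝ᵥ ((M ^ (i+1) * (M + R • (1 : Matrix ι ι ℝ)) ^ b) *ᵥ v) +
        R * v ⬝ᵥ ((M ^ i * (M + R • (1 : Matrix ι ι ℝ)) ^ b) *ᵥ v) := by
      rw [pow_succ' (M + _), Matrix.add_mul, Matrix.mul_add, Matrix.add_mulVec, dotProduct_add,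
        pow_succ, Matrix.mul_assoc]
      congr 1
      simp [Matrix.smul_mulVec, dotProduct_smul]
    rw [e1, e2]
    have hq : 0 ≤ v ⬝ᵥ (M ^ i *ᵥ v) := by
      simpa using (S_facts M hM v R hR i 0).1
    have h0 := ih 0
    have := (S_facts M hM v R hR i b).2
    have h4 := mul_le_mul_of_nonneg_left h0 hq
    rw [pow_zero, one_mul, one_mul] at h4
    rw [pow_zero, one_mul]
    linarith [ih (i+1)]

lemma quad_eq_trace {ι : Type*} [Fintype ι] (P : Matrix ι ι ℝ) (v : ι → ℝ) :
    v ⬝ᵥ (P *ᵥ v) = (P * vecMulVec v v).trace := by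
  rw [mul_vecMulVec, trace_vecMulVec, dotProduct_comm]

/-- One step of the moment growth. -/
lemma step {ι E : Type*} [Fintype ι] [DecidableEq ι] [Fintype E] (M : Matrix ι ι ℝ)
    (hM : M.PosSemidef) (v : E → ι → ℝ) (hv : ∑ e, vecMulVec (v e) (v e) = 1)
    (R : ℝ) (hR : ∀ e, v e ⬝ᵥ v e ≤ R) (γ : E → ℝ) (g : ℝ) (h0 : ∀ e, 0 ≤ γ e)
    (hγ : ∀ e, γ e ≤ g * R) (b : ℕ) : ∀ i : ℕ,
    ∑ e, γ e * (M ^ i * (M + vecMulVec (v e) (v e)) ^ b).trace ≤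
      (∑ e, γ e) * (M ^ (i + b)).trace +
        g * ((M ^ i * (M + R • (1 : Matrix ι ι ℝ)) ^ b).trace - (M ^ (i+b)).trace) := by
  induction b with
  | zero => intro i; simp [Finset.sum_mul]
  | succ b ih =>
    intro i
    have e1 : ∀ e, (M ^ i * (M + vecMulVec (v e) (v e)) ^ (b+1)).trace =
        (M ^ (i+1) * (M + vecMulVec (v e) (v e)) ^ b).trace +
        v e ⬝ᵥ ((M ^ i * (M + vecMulVec (v e) (v e)) ^ b) *ᵥ v e) := by
      intro e
      rw [quad_eq_trace, pow_succ (M + _), ← Matrix.mul_assoc, Matrix.mul_add, trace_add,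
        trace_mul_comm _ M, ← Matrix.mul_assoc, ← pow_succ']
    have e2 : (M ^ i * (M + R • (1 : Matrix ι ι ℝ)) ^ (b+1)).trace =
        (M ^ (i+1) * (M + R • (1 : Matrix ι ι ℝ)) ^ b).trace +
        R * (M ^ i * (M + R • (1 : Matrix ι ι ℝ)) ^ b).trace := by
      rw [pow_succ (M + _), ← Matrix.mul_assoc, Matrix.mul_add, trace_add,
        trace_mul_comm _ M, ← Matrix.mul_assoc, ← pow_succ']
      simp
    have e3 : ∑ e, γ e * (v e ⬝ᵥ ((M ^ i * (M + vecMulVec (v e) (v e)) ^ b) *ᵥ v e)) ≤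
        g * R * (M ^ i * (M + R • (1 : Matrix ι ι ℝ)) ^ b).trace := by
      calc _ ≤ ∑ e, (g * R) * (v e ⬝ᵥ ((M ^ i * (M + R • (1 : Matrix ι ι ℝ)) ^ b) *ᵥ v e)) := by
            refine Finset.sum_le_sum fun e _ => ?_
            refine (mul_le_mul_of_nonneg_left (z_le M hM (v e) R (hR e) b i) (h0 e)).trans ?_
            exact mul_le_mul_of_nonneg_right (hγ e) (S_facts M hM (v e) R (hR e) i b).1
        _ = _ := by
            rw [← Finset.mul_sum]
            congr 1
            simp_rw [quad_eq_trace]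
            rw [← trace_sum, ← Matrix.mul_sum, hv, Matrix.mul_one]
    have e4 : i + (b+1) = i + 1 + b := by ring
    simp_rw [e1, mul_add, Finset.sum_add_distrib]
    rw [e2, e4]
    have := ih (i+1)
    linarith

lemma step' {ι E : Type*} [Fintype ι] [DecidableEq ι] [Fintype E] (M : Matrix ι ι ℝ)
    (hM : M.PosSemidef) (v : E → ι → ℝ) (hv : ∑ e, vecMulVec (v e) (v e) = 1)
    (R : ℝ) (hR : ∀ e, v e ⬝ᵥ v e ≤ R) (γ : E → ℝ) (g : ℝ) (h0 : ∀ e, 0 ≤ γ e)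
    (hγ : ∀ e, γ e ≤ g * R) (p : ℕ) :
    ∑ e, γ e * ((M + vecMulVec (v e) (v e)) ^ p).trace ≤
      (∑ e, γ e) * (M ^ p).trace +
        g * ∑ j ∈ range p, (M ^ j).trace * R ^ (p - j) * (p.choose j) := by
  have := step M hM v hv R hR γ g h0 hγ p 0
  simp only [pow_zero, one_mul, zero_add] at this
  refine this.trans (le_of_eq ?_)
  congr 2
  have hc : Commute M (R • (1 : Matrix ι ι ℝ)) := (Commute.one_right M).smul_right R
  rw [hc.add_pow, trace_sum, Finset.sum_range_succ]
  simp only [smul_pow, one_pow, Nat.sub_self, pow_zero, Nat.choose_self, Nat.cast_one, mul_one,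
    add_sub_cancel_right]
  refine Finset.sum_congr rfl fun j _ => ?_
  rw [← nsmul_eq_mul', trace_smul, Matrix.mul_smul, Matrix.mul_one, trace_smul]
  simp
  ring

lemma markov_trace {ι : Type*} [Fintype ι] [DecidableEq ι] (M : Matrix ι ι ℝ) (hM : M.PosSemidef)
    (τ : ℝ) (hτ : 0 ≤ τ) (y : ι → ℝ) (hy : τ * (y ⬝ᵥ y) < y ⬝ᵥ (M *ᵥ y)) (p : ℕ) :
    τ ^ p ≤ (M ^ p).trace := by
  obtain ⟨lam, U, h0, h1, h2, h3⟩ := spec_rep M hM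
  have e1 := h3 0 1 0
  simp only [pow_one, pow_zero, mul_one] at e1
  have e2 := h3 0 p 0
  simp only [pow_zero, mul_one] at e2
  have e3 : (M ^ p).trace = ∑ k, lam k ^ p := by
    rw [e2, trace_mul_comm, ← Matrix.mul_assoc, h1, Matrix.one_mul, trace_diagonal]
  rw [e3]
  have : ∃ k, τ ≤ lam k := by
    by_contra! hcon
    rw [e1, quad_diag, quad_one U h2, Finset.mul_sum] at hy
    refine absurd hy (not_lt.2 (Finset.sum_le_sum fun k _ => ?_))
    nlinarith [hcon k, sq_nonneg ((Uᵀ *ᵥ y) k)]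
  obtain ⟨k, hk⟩ := this
  exact (pow_le_pow_left₀ hτ hk p).trans
    (Finset.single_le_sum (f := fun k => lam k ^ p) (fun k _ => pow_nonneg (h0 k) p) (Finset.mem_univ k))

lemma trace_pow_nonneg {ι : Type*} [Fintype ι] [DecidableEq ι] (M : Matrix ι ι ℝ)
    (hM : M.PosSemidef) (p : ℕ) : 0 ≤ (M ^ p).trace := (hM.pow p).trace_nonneg


/-- Gram determinant of a tuple. -/
noncomputable def gr {ι E : Type*} [Fintype ι] (v : E → ι → ℝ) {t : ℕ} (s : Fin t → E) : ℝ :=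
  ((of fun i => v (s i)) * (of fun i => v (s i))ᵀ : Matrix (Fin t) (Fin t) ℝ).det

lemma psd_gram {m ι : Type*} [Fintype m] [Fintype ι] (X : Matrix m ι ℝ) : (X * Xᵀ).PosSemidef := by
  have := posSemidef_self_mul_conjTranspose X
  simpa using this

lemma gr_nonneg {ι E : Type*} [Fintype ι] (v : E → ι → ℝ) {t : ℕ} (s : Fin t → E) :
    0 ≤ gr v s := (psd_gram _).det_nonneg

lemma gr_snoc_zero {ι E : Type*} [Fintype ι] (v : E → ι → ℝ) {t : ℕ} (s : Fin t → E) (e : E)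
    (h : gr v s = 0) : gr v (Fin.snoc s e : Fin (t+1) → E) = 0 := by
  unfold gr at h ⊢
  rw [← exists_vecMul_eq_zero_iff] at h ⊢
  obtain ⟨x, hx0, hx⟩ := h
  have hX : x ᵥ* (of fun i => v (s i)) = 0 := by
    rw [← dotProduct_self_eq_zero]
    have := congrArg (fun y => y ⬝ᵥ x) hx
    simp only [← vecMul_vecMul, zero_dotProduct] at this
    rw [← this]
    conv_rhs => rw [← dotProduct_mulVec]
    rw [mulVec_transpose]
  refine ⟨Fin.snoc x 0, ?_, ?_⟩
  · intro h0
    apply hx0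
    ext i
    have := congrFun h0 (Fin.castSucc i)
    simpa using this
  · rw [← vecMul_vecMul]
    have : (Fin.snoc x 0 : Fin (t+1) → ℝ) ᵥ* (of fun i => v ((Fin.snoc s e : Fin (t+1) → E) i)) = 0 := by
      rw [← hX]
      ext a
      simp [vecMul, dotProduct, Fin.sum_univ_castSucc]
    rw [this, zero_vecMul]

lemma gr_snoc {ι E : Type*} [Fintype ι] (v : E → ι → ℝ) {t : ℕ} (s : Fin t → E) (e : E)
    (h : gr v s ≠ 0) (X : Matrix (Fin t) ι ℝ) (hX : X = of fun i => v (s i)) :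
    gr v (Fin.snoc s e : Fin (t+1) → E) =
      gr v s * (v e ⬝ᵥ v e - (X *ᵥ v e) ⬝ᵥ ((X * Xᵀ)⁻¹ *ᵥ (X *ᵥ v e))) := by
  have hu : IsUnit (X * Xᵀ).det := by
    rw [hX]; exact isUnit_iff_ne_zero.2 h
  let _ := invertibleOfIsUnitDet (X * Xᵀ) hu
  have h1 : gr v (Fin.snoc s e : Fin (t+1) → E) =
      (fromBlocks (X * Xᵀ) (of fun i (_ : Fin 1) => (X *ᵥ v e) i)
        (of fun (_ : Fin 1) i => (X *ᵥ v e) i) (of fun _ _ => v e ⬝ᵥ v e)).det := by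
    unfold gr
    rw [← det_submatrix_equiv_self (finSumFinEquiv (m := t) (n := 1))]
    congr 1
    have hc : ∀ x : Fin t, (Fin.snoc s e : Fin (t+1) → E) (Fin.castAdd 1 x) = s x :=
      fun x => Fin.snoc_castSucc (α := fun _ => E) e s x
    have hl : ∀ x : Fin 1, (Fin.snoc s e : Fin (t+1) → E) (Fin.natAdd t x) = e := by
      intro x
      have : Fin.natAdd t x = Fin.last t := by ext; simp
      rw [this]
      exact Fin.snoc_last (α := fun _ => E) e s
    ext i j
    rcases i with i | i <;> rcases j with j | j <;>
      simp only [submatrix_apply, finSumFinEquiv_apply_left, finSumFinEquiv_apply_right, mul_apply, transpose_apply, of_apply,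
        fromBlocks_apply₁₁, fromBlocks_apply₁₂, fromBlocks_apply₂₁, fromBlocks_apply₂₂, hc, hl, hX,
        mulVec, dotProduct, mul_comm]
  rw [h1, det_fromBlocks₁₁, invOf_eq_nonsing_inv]
  have : (X * Xᵀ).det = gr v s := by rw [hX]; rfl
  rw [this]
  congr 1
  rw [det_fin_one]
  rw [Matrix.sub_apply]
  simp only [of_apply]
  congr 1
  rw [dotProduct_mulVec, dotProduct]
  simp only [mul_apply, of_apply, vecMul, dotProduct]

lemma gr_snoc_le {ι E : Type*} [Fintype ι] (v : E → ι → ℝ) {t : ℕ} (s : Fin t → E) (e : E) :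
    gr v (Fin.snoc s e : Fin (t+1) → E) ≤ gr v s * (v e ⬝ᵥ v e) := by
  by_cases h : gr v s = 0
  · rw [gr_snoc_zero v s e h, h, zero_mul]
  · rw [gr_snoc v s e h _ rfl]
    refine mul_le_mul_of_nonneg_left ?_ (gr_nonneg v s)
    have := ((psd_gram (of fun i => v (s i))).inv).dotProduct_mulVec_nonneg ((of fun i => v (s i)) *ᵥ v e)
    simp only [star_trivial] at this
    linarith

lemma sum_norm {ι E : Type*} [Fintype ι] [DecidableEq ι] [Fintype E] (v : E → ι → ℝ)
    (hv : ∑ e, vecMulVec (v e) (v e) = 1) : ∑ e, v e ⬝ᵥ v e = Fintype.card ι := by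
  have : ∑ e, v e ⬝ᵥ v e = (∑ e, vecMulVec (v e) (v e)).trace := by
    simp [trace_sum, trace_vecMulVec]
  rw [this, hv, trace_one]

lemma gr_snoc_sum {ι E : Type*} [Fintype ι] [DecidableEq ι] [Fintype E] (v : E → ι → ℝ)
    (hv : ∑ e, vecMulVec (v e) (v e) = 1) {t : ℕ} (s : Fin t → E) :
    ∑ e, gr v (Fin.snoc s e : Fin (t+1) → E) = ((Fintype.card ι : ℝ) - t) * gr v s := by
  by_cases h : gr v s = 0
  · simp [gr_snoc_zero v s _ h, h]
  · simp_rw [gr_snoc v s _ h _ rfl]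
    rw [← Finset.mul_sum, Finset.sum_sub_distrib, sum_norm v hv, mul_comm]
    congr 2
    set X : Matrix (Fin t) ι ℝ := of fun i => v (s i) with hX
    have hu : IsUnit (X * Xᵀ).det := isUnit_iff_ne_zero.2 h
    have : ∀ e, (X *ᵥ v e) ⬝ᵥ ((X * Xᵀ)⁻¹ *ᵥ (X *ᵥ v e)) =
        ((Xᵀ * (X * Xᵀ)⁻¹ * X) * vecMulVec (v e) (v e)).trace := by
      intro e
      rw [← quad_eq_trace, ← mulVec_mulVec, ← mulVec_mulVec, dotProduct_mulVec (v e) Xᵀ,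
        vecMul_transpose]
    simp_rw [this]
    rw [← trace_sum, ← Matrix.mul_sum, hv, Matrix.mul_one, Matrix.mul_assoc, trace_mul_comm,
      Matrix.mul_assoc, nonsing_inv_mul _ hu, trace_one]
    simp

lemma sum_snoc {E : Type*} [Fintype E] {t : ℕ} (f : (Fin (t+1) → E) → ℝ) :
    ∑ s, f s = ∑ s : Fin t → E, ∑ e, f (Fin.snoc s e) := by
  rw [Finset.sum_comm, ← Fintype.sum_prod_type']
  exact (Fintype.sum_equiv (Fin.snocEquiv (fun _ : Fin (t+1) => E)) _ _ (fun _ => rfl)).symm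

/-- Sum of Gram weights with prescribed first element. -/
lemma gr_sum_first {ι E : Type*} [Fintype ι] [DecidableEq ι] [Fintype E] [DecidableEq E]
    (v : E → ι → ℝ) (hv : ∑ e, vecMulVec (v e) (v e) = 1) (k : ℕ)
    (hk : Fintype.card ι = k + 1) (e : E) (t : ℕ) (ht : t ≤ k) :
    ∑ s : Fin (t+1) → E, gr v s * (if s 0 = e then 1 else 0) =
      (k.descFactorial t : ℝ) * (v e ⬝ᵥ v e) := by
  induction t with
  | zero =>
    rw [sum_snoc]
    have : ∀ (s : Fin 0 → E) (e : E), (Fin.snoc s e : Fin 1 → E) 0 = e := by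
      intro s e
      exact Fin.snoc_last (α := fun _ => E) e s
    simp [this, gr, mul_apply, dotProduct]
  | succ t ih =>
    rw [sum_snoc]
    have : ∀ (s : Fin (t+1) → E) (e : E), (Fin.snoc s e : Fin (t+1+1) → E) 0 = s 0 := by
      intro s e
      exact Fin.snoc_castSucc (α := fun _ => E) e s 0
    simp_rw [this, ← Finset.sum_mul, gr_snoc_sum v hv, mul_assoc]
    rw [← Finset.mul_sum, ih (by omega), hk, Nat.descFactorial_succ]
    rw [← mul_assoc]
    congr 1
    have : t ≤ k := by omega
    push_cast [Nat.cast_sub this]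
    ring

lemma gr_sum_first' {ι E : Type*} [Fintype ι] [DecidableEq ι] [Fintype E] [DecidableEq E]
    (v : E → ι → ℝ) (hv : ∑ e, vecMulVec (v e) (v e) = 1) (k : ℕ)
    (hk : Fintype.card ι = k + 1) (e : E) :
    ∑ s : Fin (k+1) → E, gr v s * (if s 0 = e then 1 else 0) = (k.factorial : ℝ) * (v e ⬝ᵥ v e) := by
  rw [gr_sum_first v hv k hk e k le_rfl, Nat.descFactorial_self]

lemma gr_sum_total {ι E : Type*} [Fintype ι] [DecidableEq ι] [Fintype E] [DecidableEq E]
    (v : E → ι → ℝ) (hv : ∑ e, vecMulVec (v e) (v e) = 1) (k : ℕ)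
    (hk : Fintype.card ι = k + 1) :
    ∑ s : Fin (k+1) → E, gr v s = ((k+1).factorial : ℝ) := by
  have h1 : ∑ s : Fin (k+1) → E, gr v s =
      ∑ e, ∑ s : Fin (k+1) → E, gr v s * (if s 0 = e then 1 else 0) := by
    rw [Finset.sum_comm]
    simp
  rw [h1]
  simp_rw [gr_sum_first' v hv k hk]
  rw [← Finset.mul_sum, sum_norm v hv, hk, Nat.factorial_succ]
  push_cast; ring

lemma inv_fact_sum (p : ℕ) : ∑ j ∈ range p, (1 : ℝ) / ((p - j).factorial : ℝ) ≤ 2 := by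
  have h1 : ∑ j ∈ range p, (1 : ℝ) / ((p - j).factorial : ℝ) =
      ∑ i ∈ range p, (1 : ℝ) / ((i + 1).factorial : ℝ) := by
    rw [← Finset.sum_range_reflect]
    refine Finset.sum_congr rfl fun i hi => ?_
    have := Finset.mem_range.1 hi
    congr 3
    omega
  have h2 : ∀ i : ℕ, (1 : ℝ) / ((i + 1).factorial : ℝ) ≤ (1/2 : ℝ) ^ i := by
    intro i
    induction i with
    | zero => simp
    | succ i ih =>
      rw [Nat.factorial_succ, pow_succ]
      push_cast
      rw [one_div, mul_inv, mul_comm, ← one_div]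
      refine mul_le_mul ih ?_ (by positivity) (by positivity)
      rw [one_div]
      apply inv_anti₀ (by norm_num)
      have : (0:ℝ) ≤ i := Nat.cast_nonneg i
      linarith
  have h3 : ∀ p : ℕ, ∑ i ∈ range p, (1/2 : ℝ) ^ i = 2 - 2 * (1/2)^p := by
    intro p
    induction p with
    | zero => simp
    | succ p ih => rw [Finset.sum_range_succ, ih, pow_succ]; ring
  rw [h1]
  refine (Finset.sum_le_sum fun i _ => h2 i).trans ?_
  rw [h3]
  have : (0:ℝ) ≤ (1/2)^p := by positivity
  linarith

/-- The random matrix of a tuple. -/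
noncomputable def mat {ι E : Type*} (v : E → ι → ℝ) {t : ℕ} (s : Fin t → E) : Matrix ι ι ℝ :=
  ∑ i, vecMulVec (v (s i)) (v (s i))

lemma mat_psd {ι E : Type*} [Fintype ι] (v : E → ι → ℝ) {t : ℕ} (s : Fin t → E) :
    (mat v s).PosSemidef := by
  refine posSemidef_sum _ fun i _ => ?_
  have := posSemidef_vecMulVec_self_star (v (s i))
  simpa using this

lemma mat_snoc {ι E : Type*} (v : E → ι → ℝ) {t : ℕ} (s : Fin t → E) (e : E) :
    mat v (Fin.snoc s e : Fin (t+1) → E) = mat v s + vecMulVec (v e) (v e) := by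
  simp [mat, Fin.sum_univ_castSucc]

noncomputable def H (k : ℕ) : ℕ → ℝ
  | 0 => k
  | t + 1 => H k t * ((k : ℝ) - t + 2)

lemma H_nonneg (k t : ℕ) (h : t ≤ k) : 0 ≤ H k t := by
  induction t with
  | zero => simp [H]
  | succ t ih =>
    have : ((t+1 : ℕ) : ℝ) ≤ k := Nat.cast_le.2 h
    push_cast at this
    exact mul_nonneg (ih (by omega)) (by linarith)

lemma H_eq (k t : ℕ) (h : t ≤ k) : H k t * ((k - t + 2).factorial : ℝ) = k * (k + 2).factorial := by
  induction t with
  | zero => simp [H]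
  | succ t ih =>
    obtain ⟨d, rfl⟩ := Nat.exists_eq_add_of_le h
    rw [← ih (by omega)]
    have e1 : t + 1 + d - t + 2 = (d + 2) + 1 := by omega
    have e2 : t + 1 + d - (t + 1) + 2 = d + 2 := by omega
    rw [e1, e2, Nat.factorial_succ (d + 2)]
    simp only [H]
    push_cast
    ring

lemma H_final (k : ℕ) : H k k = k * (k+1) * (k+2) / 2 * (k.factorial : ℝ) := by
  have := H_eq k k le_rfl
  rw [Nat.sub_self, Nat.factorial_succ (k+1), Nat.factorial_succ k] at this
  simp [Nat.factorial] at this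
  linarith

lemma moment {ι E : Type*} [Fintype ι] [DecidableEq ι] [Fintype E]
    (v : E → ι → ℝ) (hv : ∑ e, vecMulVec (v e) (v e) = 1) (R : ℝ) (hR0 : 0 ≤ R)
    (hR : ∀ e, v e ⬝ᵥ v e ≤ R) (t : ℕ) (ht : t ≤ Fintype.card ι) : ∀ p : ℕ,
    ∑ s : Fin t → E, gr v s * ((mat v s) ^ p).trace ≤
      H (Fintype.card ι) t * (p.factorial * R ^ p) := by
  induction t with
  | zero =>
    intro p
    rcases Nat.eq_zero_or_pos p with rfl | hp
    · simp [H, gr, mat]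
    · have : p ≠ 0 := by omega
      simp [H, gr, mat, this]
      positivity
  | succ t ih =>
    intro p
    have ih := ih (by omega)
    set k := Fintype.card ι with hk
    have hkt : (t : ℝ) ≤ k := Nat.cast_le.2 (by omega)
    have hH := H_nonneg k t (by omega)
    rw [sum_snoc]
    have h1 : ∀ s : Fin t → E, ∑ e, gr v (Fin.snoc s e : Fin (t+1) → E) *
        ((mat v (Fin.snoc s e : Fin (t+1) → E)) ^ p).trace ≤
        ((k : ℝ) - t) * (gr v s * ((mat v s) ^ p).trace) +
        ∑ j ∈ range p, (gr v s * ((mat v s) ^ j).trace) * (R ^ (p - j) * (p.choose j)) := by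
      intro s
      simp_rw [mat_snoc]
      refine (step' (mat v s) (mat_psd v s) v hv R hR
        (fun e => gr v (Fin.snoc s e : Fin (t+1) → E)) (gr v s) (fun e => gr_nonneg v _)
        (fun e => (gr_snoc_le v s e).trans (mul_le_mul_of_nonneg_left (hR e) (gr_nonneg v s))) p).trans
        (le_of_eq ?_)
      rw [gr_snoc_sum v hv, Finset.mul_sum, mul_assoc]
      congr 1
      exact Finset.sum_congr rfl fun j _ => by ring
    refine (Finset.sum_le_sum fun s _ => h1 s).trans ?_
    rw [Finset.sum_add_distrib, ← Finset.mul_sum, Finset.sum_comm]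
    simp_rw [← Finset.sum_mul]
    have h2 : ∑ j ∈ range p, (∑ s : Fin t → E, gr v s * ((mat v s) ^ j).trace) *
        (R ^ (p - j) * (p.choose j)) ≤ H k t * (p.factorial * R ^ p) * 2 := by
      calc _ ≤ ∑ j ∈ range p, (H k t * (p.factorial * R ^ p)) * (1 / ((p - j).factorial : ℝ)) := by
            refine Finset.sum_le_sum fun j hj => ?_
            refine (mul_le_mul_of_nonneg_right (ih j) (by positivity)).trans (le_of_eq ?_)
            have hjp : j ≤ p := (Finset.mem_range.1 hj).le
            have e1 : R ^ p = R ^ j * R ^ (p - j) := by rw [← pow_add]; congr 1; omega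
            have e2 : (p.factorial : ℝ) = p.choose j * j.factorial * (p - j).factorial := by
              exact_mod_cast (Nat.choose_mul_factorial_mul_factorial hjp).symm
            have e3 : ((p - j).factorial : ℝ) ≠ 0 := by positivity
            rw [e1, e2]
            field_simp
        _ ≤ _ := by
            rw [← Finset.mul_sum]
            exact mul_le_mul_of_nonneg_left (inv_fact_sum p) (by positivity)
    have h3 := mul_le_mul_of_nonneg_left (ih p) (sub_nonneg.2 hkt)
    simp only [H]
    calc _ ≤ _ := add_le_add h3 h2
      _ = _ := by ring


/-- Reduced (grounded at vertex 0) signed incidence vector of an edge. -/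
def bb (α : Type*) [Ring α] {m : ℕ} (G : SimpleGraph (Fin (m+1))) (e : Sym2 (Fin (m+1))) :
    Fin m → α := fun i =>
  if e ∈ G.edgeSet then (if e.out.1 = i.succ then 1 else 0) - (if e.out.2 = i.succ then 1 else 0)
  else 0

lemma out_mk {V : Type*} (e : Sym2 V) : s(e.out.1, e.out.2) = e := Quot.out_eq e

lemma bb_dot {α : Type*} [CommRing α] {m : ℕ} (G : SimpleGraph (Fin (m+1)))
    (e : Sym2 (Fin (m+1))) (he : e ∈ G.edgeSet) (y : Fin (m+1) → α) :
    bb α G e ⬝ᵥ (fun i => y i.succ - y 0) = y e.out.1 - y e.out.2 := by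
  have key : ∀ a : Fin (m+1), ∑ i : Fin m, (if a = i.succ then (1:α) else 0) * (y i.succ - y 0) =
      y a - y 0 := by
    intro a
    have := Fin.sum_univ_succ (fun j : Fin (m+1) => (if a = j then (1:α) else 0) * (y j - y 0))
    simp only [sub_self, mul_zero, zero_add] at this
    rw [← this]
    simp
  simp only [dotProduct, bb, he, if_true, sub_mul, Finset.sum_sub_distrib, key]
  ring

lemma bb_cast {m : ℕ} (G : SimpleGraph (Fin (m+1))) (e : Sym2 (Fin (m+1))) (i : Fin m) :
    bb ℝ G e i = ((bb ℤ G e i : ℤ) : ℝ) := by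
  unfold bb
  split_ifs <;> simp

lemma bb_notMem {α : Type*} [Ring α] {m : ℕ} (G : SimpleGraph (Fin (m+1)))
    (e : Sym2 (Fin (m+1))) (he : e ∉ G.edgeSet) : bb α G e = 0 := by
  ext i; simp [bb, he]

lemma tree_det {m : ℕ} (G : SimpleGraph (Fin (m+1))) (s : Fin m → Sym2 (Fin (m+1)))
    (hT : IsSpanningTree (m+1) G (univ.image s)) :
    (of (fun i => bb ℤ G (s i))).det ^ 2 = 1 := by
  obtain ⟨hsub, hconn, hcard⟩ := hT
  have hinj : Function.Injective s := by
    have : (univ.image s).card = (univ : Finset (Fin m)).card := by rw [hcard]; simp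
    have := Finset.card_image_iff.1 this
    simpa using this
  have hmem : ∀ i, s i ∈ G.edgeSet := fun i => hsub (by simp)
  set T := SimpleGraph.fromEdgeSet (↑(univ.image s) : Set (Sym2 (Fin (m+1)))) with hTdef
  have hTe : T.edgeSet = ↑(univ.image s) := by
    rw [hTdef, SimpleGraph.edgeSet_fromEdgeSet]
    ext e
    simp only [Set.mem_sdiff]
    refine ⟨fun h => h.1, fun h => ⟨h, ?_⟩⟩
    exact G.not_isDiag_of_mem_edgeSet (hsub h)
  have htree : T.IsTree := by
    rw [SimpleGraph.isTree_iff_connected_and_card]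
    refine ⟨hconn, ?_⟩
    rw [hTe]
    simp only [Nat.card_coe_set_eq, Set.ncard_coe_finset]
    rw [hcard]; simp
  have hbr := SimpleGraph.isAcyclic_iff_forall_isBridge.1 htree.isAcyclic
  have hx : ∀ j : Fin m, ∃ x : Fin m → ℤ, ∀ i, bb ℤ G (s i) ⬝ᵥ x = if i = j then 1 else 0 := by
    intro j
    have hb : T.IsBridge (s j) := hbr (by rw [hTe]; simp)
    rw [← out_mk (s j), SimpleGraph.isBridge_iff, out_mk] at hb
    let y : Fin (m+1) → ℤ := fun w =>
      if (T.deleteEdges {s j}).Reachable (s j).out.1 w then 1 else 0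
    refine ⟨fun i => y i.succ - y 0, fun i => ?_⟩
    rw [bb_dot G _ (hmem i)]
    by_cases hij : i = j
    · subst hij
      have h1 : (T.deleteEdges {s i}).Reachable (s i).out.1 (s i).out.1 :=
        SimpleGraph.Reachable.refl _
      simp only [y, hb, if_true, if_false, sub_zero]
      simp
    · have hadj : (T.deleteEdges {s j}).Adj (s i).out.1 (s i).out.2 := by
        rw [← SimpleGraph.mem_edgeSet, out_mk, SimpleGraph.edgeSet_deleteEdges, hTe]
        refine ⟨by simp, ?_⟩
        simp only [Set.mem_singleton_iff]
        exact fun h => hij (hinj h)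
      have : (T.deleteEdges {s j}).Reachable (s j).out.1 (s i).out.1 ↔
          (T.deleteEdges {s j}).Reachable (s j).out.1 (s i).out.2 :=
        ⟨fun h => h.trans hadj.reachable, fun h => h.trans hadj.symm.reachable⟩
      simp only [y, this, sub_self, hij, if_false]
  choose x hx using hx
  have hprod : (of (fun i => bb ℤ G (s i))) * (of (fun i j => x j i)) = 1 := by
    ext i j
    rw [mul_apply, one_apply]
    exact hx j i
  have hdet := congrArg det hprod
  rw [det_mul, det_one] at hdet
  rcases Int.isUnit_iff.1 (IsUnit.of_mul_eq_one _ hdet) with h | h <;> rw [h] <;> norm_num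

lemma not_tree_det {m : ℕ} (G : SimpleGraph (Fin (m+1))) (s : Fin m → Sym2 (Fin (m+1)))
    (hT : ¬ IsSpanningTree (m+1) G (univ.image s)) :
    (of (fun i => bb ℤ G (s i))).det = 0 := by
  by_cases hmem : ∀ i, s i ∈ G.edgeSet
  swap
  · push Not at hmem
    obtain ⟨i, hi⟩ := hmem
    refine det_eq_zero_of_row_eq_zero i fun j => ?_
    simp [bb_notMem G _ hi]
  by_cases hinj : Function.Injective s
  swap
  · rw [Function.Injective] at hinj
    push Not at hinj
    obtain ⟨i, j, hij, hne⟩ := hinj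
    exact det_zero_of_row_eq hne (by ext k; simp [hij])
  have hcard : (univ.image s).card = m + 1 - 1 := by
    rw [Finset.card_image_of_injective _ hinj]; simp
  have hsub : (↑(univ.image s) : Set (Sym2 (Fin (m+1)))) ⊆ G.edgeSet := by
    intro e he
    simp at he
    obtain ⟨i, rfl⟩ := he
    exact hmem i
  have hconn : ¬ (SimpleGraph.fromEdgeSet (↑(univ.image s) : Set (Sym2 (Fin (m+1))))).Connected :=
    fun h => hT ⟨hsub, h, hcard⟩
  set T := SimpleGraph.fromEdgeSet (↑(univ.image s) : Set (Sym2 (Fin (m+1)))) with hTdef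
  have hex : ∃ w, ¬ T.Reachable 0 w := by
    by_contra! h
    exact hconn ⟨fun a b => (h a).symm.trans (h b)⟩
  obtain ⟨w, hw⟩ := hex
  let y : Fin (m+1) → ℤ := fun w => if T.Reachable 0 w then 1 else 0
  rw [← exists_mulVec_eq_zero_iff]
  refine ⟨fun i => y i.succ - y 0, ?_, ?_⟩
  · intro h
    have hw0 : w ≠ 0 := by rintro rfl; exact hw (SimpleGraph.Reachable.refl _)
    obtain ⟨i, rfl⟩ := Fin.exists_succ_eq.2 hw0
    have := congrFun h i
    simp [y, hw] at this
  · ext i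
    change bb ℤ G (s i) ⬝ᵥ _ = 0
    rw [bb_dot G _ (hmem i)]
    have hadj : T.Adj (s i).out.1 (s i).out.2 := by
      rw [hTdef, SimpleGraph.fromEdgeSet_adj, out_mk]
      refine ⟨by simp, ?_⟩
      have : G.Adj (s i).out.1 (s i).out.2 := by
        rw [← SimpleGraph.mem_edgeSet, out_mk]; exact hmem i
      exact this.ne
    have : T.Reachable 0 (s i).out.1 ↔ T.Reachable 0 (s i).out.2 :=
        ⟨fun h => h.trans hadj.reachable, fun h => h.trans hadj.symm.reachable⟩
    simp only [y, this, sub_self]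

lemma det_sq {m : ℕ} (G : SimpleGraph (Fin (m+1))) (s : Fin m → Sym2 (Fin (m+1))) :
    (of (fun i => bb ℝ G (s i))).det ^ 2 =
      if IsSpanningTree (m+1) G (univ.image s) then 1 else 0 := by
  have h : (of (fun i => bb ℝ G (s i))).det = (((of (fun i => bb ℤ G (s i))).det : ℤ) : ℝ) := by
    have := (Int.castRingHom ℝ).map_det (of (fun i => bb ℤ G (s i)))
    simp only [eq_intCast] at this
    rw [this]
    congr 1
    ext i j
    simp [bb_cast]
  rw [h]
  split_ifs with hT
  · exact_mod_cast tree_det G s hT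
  · rw [not_tree_det G s hT]; simp

/-- The quadratic form of an edge. -/
lemma edge_quad {n : ℕ} (G : SimpleGraph (Fin n)) (e : Sym2 (Fin n)) (he : e ∈ G.edgeSet)
    (x : Fin n → ℝ) : x ⬝ᵥ (edgeMat n e *ᵥ x) = (x e.out.1 - x e.out.2) ^ 2 := by
  have hadj : G.Adj e.out.1 e.out.2 := by
    rw [← SimpleGraph.mem_edgeSet, out_mk]; exact he
  have hne := hadj.ne
  set u := e.out.1
  set w := e.out.2
  have hm : edgeMat n e = vecMulVec (Pi.single u 1 - Pi.single w 1) (Pi.single u 1 - Pi.single w 1) := by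
    ext i j
    have hmem : ∀ i, i ∈ e ↔ i = u ∨ i = w := by
      intro i
      rw [← out_mk e, Sym2.mem_iff]
    simp only [edgeMat, hmem, vecMulVec_apply, Pi.sub_apply, Pi.single_apply]
    grind
  rw [hm, vecMulVec_mulVec]
  simp [sub_dotProduct, dotProduct_sub]
  ring

lemma lap_quad {m : ℕ} (G : SimpleGraph (Fin (m+1))) (x : Fin (m+1) → ℝ) :
    x ⬝ᵥ (lap (m+1) G 1 *ᵥ x) = ∑ e, (bb ℝ G e ⬝ᵥ (fun i => x i.succ - x 0)) ^ 2 := by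
  unfold lap
  rw [Matrix.sum_mulVec, dotProduct_sum]
  refine Finset.sum_congr rfl fun e _ => ?_
  by_cases he : e ∈ G.edgeSet
  · rw [bb_dot G e he, ← edge_quad G e he]
    simp [he]
  · simp [he, bb_notMem G e he]

lemma posdef_red {m : ℕ} (G : SimpleGraph (Fin (m+1))) (hG : G.Connected) :
    (∑ e, vecMulVec (bb ℝ G e) (bb ℝ G e)).PosDef := by
  refine PosDef.of_dotProduct_mulVec_pos ?_ ?_
  · refine (posSemidef_sum _ fun e _ => ?_).1
    have := posSemidef_vecMulVec_self_star (bb ℝ G e)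
    simpa using this
  · intro x hx
    have hq : star x ⬝ᵥ ((∑ e, vecMulVec (bb ℝ G e) (bb ℝ G e)) *ᵥ x) = ∑ e, (bb ℝ G e ⬝ᵥ x) ^ 2 := by
      rw [Matrix.sum_mulVec, dotProduct_sum]
      refine Finset.sum_congr rfl fun e _ => ?_
      rw [vecMulVec_mulVec]
      simp [dotProduct_comm, sq]
    rw [hq]
    refine lt_of_le_of_ne (Finset.sum_nonneg fun e _ => sq_nonneg _) fun h0 => hx ?_
    have hz := (Finset.sum_eq_zero_iff_of_nonneg (fun e _ => sq_nonneg (bb ℝ G e ⬝ᵥ x))).1 h0.symm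
    let y : Fin (m+1) → ℝ := Fin.cons 0 x
    have hyx : (fun i : Fin m => y i.succ - y 0) = x := by ext i; simp [y]
    have hadj : ∀ a b, G.Adj a b → y a = y b := by
      intro a b hab
      have he : s(a, b) ∈ G.edgeSet := hab
      have h1 := hz s(a, b) (Finset.mem_univ _)
      rw [← hyx, bb_dot G _ he] at h1
      have h2 : y (s(a,b)).out.1 = y (s(a,b)).out.2 := by
        have := pow_eq_zero_iff (two_ne_zero) |>.1 h1
        linarith
      have h3 := out_mk s(a,b)
      rw [Sym2.eq_iff] at h3
      rcases h3 with ⟨h3, h4⟩ | ⟨h3, h4⟩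
      · rw [h3, h4] at h2; exact h2
      · rw [h3, h4] at h2; exact h2.symm
    have hreach : ∀ a b, G.Reachable a b → y a = y b := by
      rintro a b ⟨p⟩
      induction p with
      | nil => rfl
      | cons h _ ih => exact (hadj _ _ h).trans ih
    ext i
    have := hreach 0 i.succ (hG.preconnected _ _)
    simpa [y] using this.symm

/-- Isotropic vectors representing the edges. -/
lemma exists_iso {m : ℕ} (G : SimpleGraph (Fin (m+1))) (hG : G.Connected) :
    ∃ (X Y : Matrix (Fin m) (Fin m) ℝ), Y.det ≠ 0 ∧ Y * Xᵀ = 1 ∧ Xᵀ * Y = 1 ∧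
      ∑ e, vecMulVec (Y *ᵥ bb ℝ G e) (Y *ᵥ bb ℝ G e) = 1 := by
  have hpd := posdef_red G hG
  obtain ⟨lam, U, h0, h1, h2, h3⟩ := spec_rep _ hpd.posSemidef
  have h3 := h3 0 1 0
  simp only [pow_one, pow_zero, mul_one] at h3
  let X : Matrix (Fin m) (Fin m) ℝ := diagonal (fun k => √(lam k)) * Uᵀ
  have hX : (∑ e, vecMulVec (bb ℝ G e) (bb ℝ G e)) = Xᵀ * X := by
    rw [h3]
    simp only [X, transpose_mul, transpose_transpose, diagonal_transpose]
    have hd : diagonal (fun k => lam k) =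
        diagonal (fun k => √(lam k)) * diagonal (fun k => √(lam k)) := by
      rw [diagonal_mul_diagonal]
      simp only [Real.mul_self_sqrt (h0 _)]
    rw [hd]
    simp only [Matrix.mul_assoc]
  have hdet : Xᵀ.det ≠ 0 := by
    intro h
    have := hpd.det_pos
    rw [hX, det_mul, h, zero_mul] at this
    exact lt_irrefl _ this
  have hu : IsUnit Xᵀ.det := isUnit_iff_ne_zero.2 hdet
  refine ⟨X, Xᵀ⁻¹, ?_, nonsing_inv_mul _ hu, mul_nonsing_inv _ hu, ?_⟩
  · rw [det_nonsing_inv]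
    simpa using hdet
  · have : ∀ e, vecMulVec (Xᵀ⁻¹ *ᵥ bb ℝ G e) (Xᵀ⁻¹ *ᵥ bb ℝ G e) =
        Xᵀ⁻¹ * vecMulVec (bb ℝ G e) (bb ℝ G e) * Xᵀ⁻¹ᵀ := by
      intro e
      rw [mul_vecMulVec, vecMulVec_mul, vecMul_transpose]
    simp_rw [this]
    rw [← Matrix.sum_mul, ← Matrix.mul_sum, hX, ← Matrix.mul_assoc, nonsing_inv_mul _ hu,
      Matrix.one_mul, transpose_nonsing_inv, transpose_transpose, mul_nonsing_inv]
    rwa [det_transpose] at hu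

lemma gr_eq {m : ℕ} (G : SimpleGraph (Fin (m+1))) (Y : Matrix (Fin m) (Fin m) ℝ)
    (s : Fin m → Sym2 (Fin (m+1))) :
    gr (fun e => Y *ᵥ bb ℝ G e) s =
      Y.det ^ 2 * if IsSpanningTree (m+1) G (univ.image s) then 1 else 0 := by
  rw [← det_sq, gr, det_mul, det_transpose]
  have : (of fun i => Y *ᵥ bb ℝ G (s i)) = (of (fun i => bb ℝ G (s i))) * Yᵀ := by
    ext i j
    simp [mul_apply, mulVec, dotProduct, mul_comm]
  rw [this, det_mul, det_transpose]
  ring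

lemma card_enum {E : Type*} [Fintype E] [DecidableEq E] (m : ℕ) (T : Finset E) (hT : T.card = m) :
    (univ.filter (fun s : Fin m → E => univ.image s = T)).card = m.factorial := by
  have hc : Fintype.card (Fin m) = Fintype.card T := by simp [hT]
  have e0 : Fin m ≃ T := Fintype.equivOfCardEq hc
  have : m.factorial = (univ : Finset (Fin m ≃ T)).card := by
    rw [Finset.card_univ, Fintype.card_equiv e0]; simp
  rw [this]
  symm
  refine Finset.card_bij (fun f _ => fun i => (f i : E)) ?_ ?_ ?_
  · intro f _
    simp only [Finset.mem_filter, Finset.mem_univ, true_and]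
    ext x
    simp only [Finset.mem_image, Finset.mem_univ, true_and]
    refine ⟨?_, fun hx => ⟨f.symm ⟨x, hx⟩, by simp⟩⟩
    rintro ⟨i, rfl⟩
    exact (f i).2
  · intro f _ g _ h
    ext i
    exact congrFun h i
  · intro s hs
    simp only [Finset.mem_filter, Finset.mem_univ, true_and] at hs
    have hmem : ∀ i, s i ∈ T := fun i => by rw [← hs]; simp
    let f : Fin m → T := fun i => ⟨s i, hmem i⟩
    have hsurj : Function.Surjective f := by
      rintro ⟨x, hx⟩
      rw [← hs] at hx
      simp only [Finset.mem_image, Finset.mem_univ, true_and] at hx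
      obtain ⟨i, hi⟩ := hx
      exact ⟨i, Subtype.ext hi⟩
    have hbij : Function.Bijective f := (Fintype.bijective_iff_surjective_and_card f).2 ⟨hsurj, hc⟩
    exact ⟨Equiv.ofBijective f hbij, Finset.mem_univ _, by ext i; rfl⟩

/-- Transfer between ordered tuples and trees. -/
lemma transfer {m : ℕ} (G : SimpleGraph (Fin (m+1))) (Y : Matrix (Fin m) (Fin m) ℝ)
    (φ : Finset (Sym2 (Fin (m+1))) → ℝ) :
    ∑ s : Fin m → Sym2 (Fin (m+1)), gr (fun e => Y *ᵥ bb ℝ G e) s * φ (univ.image s) =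
      Y.det ^ 2 * m.factorial *
        ∑ T ∈ univ.filter (fun T => IsSpanningTree (m+1) G T), φ T := by
  rw [← Finset.sum_fiberwise_of_maps_to (s := univ) (t := (univ : Finset (Finset (Sym2 (Fin (m+1))))))
    (g := fun s : Fin m → Sym2 (Fin (m+1)) => univ.image s) (fun _ _ => Finset.mem_univ _)]
  rw [Finset.mul_sum, Finset.sum_filter]
  refine Finset.sum_congr rfl fun T _ => ?_
  have h1 : ∀ s ∈ univ.filter (fun s : Fin m → Sym2 (Fin (m+1)) => univ.image s = T),
      gr (fun e => Y *ᵥ bb ℝ G e) s * φ (univ.image s) =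
      Y.det ^ 2 * (if IsSpanningTree (m+1) G T then 1 else 0) * φ T := by
    intro s hs
    have := (Finset.mem_filter.1 hs).2
    rw [gr_eq, this]
  rw [Finset.sum_congr rfl h1, Finset.sum_const, nsmul_eq_mul]
  split_ifs with hT
  · rw [card_enum m T (by have := hT.2.2; simpa using this)]
    ring
  · simp


lemma total {k : ℕ} (G : SimpleGraph (Fin (k+1+1))) (Y : Matrix (Fin (k+1)) (Fin (k+1)) ℝ)
    (hv : ∑ e, vecMulVec (Y *ᵥ bb ℝ G e) (Y *ᵥ bb ℝ G e) = 1) :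
    Y.det ^ 2 * ((univ.filter (fun T => IsSpanningTree (k+1+1) G T)).card : ℝ) = 1 := by
  have h1 := transfer G Y (fun _ => 1)
  simp only [mul_one, Finset.sum_const, nsmul_eq_mul] at h1
  rw [gr_sum_total (fun e => Y *ᵥ bb ℝ G e) hv k (by simp)] at h1
  have h2 : ((k+1).factorial : ℝ) ≠ 0 := by positivity
  apply mul_left_cancel₀ h2
  linarith

lemma treeProb_eq {n : ℕ} (G : SimpleGraph (Fin n)) (T : Finset (Sym2 (Fin n))) :
    treeProb n G 1 T = (if IsSpanningTree n G T then 1 else 0) /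
      ((univ.filter (fun T => IsSpanningTree n G T)).card : ℝ) := by
  simp [treeProb, treeWt]

lemma lev_eq {k : ℕ} (G : SimpleGraph (Fin (k+1+1))) (Y : Matrix (Fin (k+1)) (Fin (k+1)) ℝ)
    (hv : ∑ e, vecMulVec (Y *ᵥ bb ℝ G e) (Y *ᵥ bb ℝ G e) = 1) (e : Sym2 (Fin (k+1+1))) :
    (Y *ᵥ bb ℝ G e) ⬝ᵥ (Y *ᵥ bb ℝ G e) = lev (k+1+1) G 1 e := by
  set v := fun e => Y *ᵥ bb ℝ G e with hvdef
  have htot := total G Y hv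
  set N : ℝ := ((univ.filter (fun T => IsSpanningTree (k+1+1) G T)).card : ℝ) with hN
  have hlev : lev (k+1+1) G 1 e = Y.det ^ 2 *
      ∑ T ∈ univ.filter (fun T => IsSpanningTree (k+1+1) G T), if e ∈ T then 1 else 0 := by
    have hN0 : N ≠ 0 := by rintro h; rw [h] at htot; simp at htot
    have hdet : Y.det ^ 2 = 1 / N := by field_simp; exact htot
    unfold lev
    rw [Finset.mul_sum, ← Finset.sum_filter_add_sum_filter_not
      (univ.filter (fun T => IsSpanningTree (k+1+1) G T)) (fun T => e ∈ T)]
    rw [Finset.filter_filter]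
    have z : ∑ x ∈ (univ.filter (fun T => IsSpanningTree (k+1+1) G T)).filter (fun T => ¬ e ∈ T),
        Y.det ^ 2 * (if e ∈ x then (1:ℝ) else 0) = 0 := by
      refine Finset.sum_eq_zero fun T hT => ?_
      simp [(Finset.mem_filter.1 hT).2]
    rw [z, add_zero]
    refine Finset.sum_congr rfl fun T hT => ?_
    have := (Finset.mem_filter.1 hT).2
    rw [treeProb_eq, hdet]
    simp [this.1, this.2]
    rfl
  rw [hlev]
  have htr := transfer G Y (fun T => if e ∈ T then 1 else 0)
  have hsum : ∀ s : Fin (k+1) → Sym2 (Fin (k+1+1)),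
      gr v s * (if e ∈ univ.image s then 1 else 0) = ∑ i, gr v s * (if s i = e then 1 else 0) := by
    intro s
    rw [← Finset.mul_sum]
    by_cases hg : gr v s = 0
    · simp [hg]
    congr 1
    have hT : IsSpanningTree (k+1+1) G (univ.image s) := by
      by_contra hcon
      apply hg
      rw [hvdef, gr_eq]
      simp [hcon]
    have hinj : Function.Injective s := by
      have h1 : (univ.image s).card = (univ : Finset (Fin (k+1))).card := by rw [hT.2.2]; simp
      have := Finset.card_image_iff.1 h1
      simpa using this
    by_cases he : e ∈ univ.image s
    · rw [if_pos he]
      simp only [Finset.mem_image, Finset.mem_univ, true_and] at he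
      obtain ⟨j, rfl⟩ := he
      simp [hinj.eq_iff]
    · rw [if_neg he]
      simp only [Finset.mem_image, Finset.mem_univ, true_and, not_exists] at he
      symm
      exact Finset.sum_eq_zero fun i _ => by simp [he i]
  have hsym : ∀ i : Fin (k+1), ∑ s : Fin (k+1) → Sym2 (Fin (k+1+1)), gr v s * (if s i = e then 1 else 0) =
      (k.factorial : ℝ) * (v e ⬝ᵥ v e) := by
    intro i
    rw [← gr_sum_first' v hv k (by simp) e]
    refine Fintype.sum_equiv ((Equiv.swap 0 i).arrowCongr (Equiv.refl _)) _ _ fun s => ?_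
    have e1 : ((Equiv.swap 0 i).arrowCongr (Equiv.refl (Sym2 (Fin (k+1+1)))) s) = s ∘ (Equiv.swap 0 i) := by
      ext j
      simp [Equiv.arrowCongr]
    rw [e1]
    have e2 : univ.image (s ∘ (Equiv.swap 0 i)) = univ.image s := by
      ext x
      simp only [Finset.mem_image, Finset.mem_univ, true_and, Function.comp]
      exact (Equiv.swap 0 i).surjective.exists (p := fun j => s j = x) |>.symm
    rw [hvdef, gr_eq, gr_eq, e2]
    simp
  have hall : ∑ s : Fin (k+1) → Sym2 (Fin (k+1+1)), gr v s * (if e ∈ univ.image s then 1 else 0) =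
      ((k+1).factorial : ℝ) * (v e ⬝ᵥ v e) := by
    simp_rw [hsum]
    rw [Finset.sum_comm]
    simp_rw [hsym]
    rw [Finset.sum_const, nsmul_eq_mul, Nat.factorial_succ]
    simp
    ring
  have h2 : ((k+1).factorial : ℝ) ≠ 0 := by positivity
  apply mul_left_cancel₀ h2
  change _ * (v e ⬝ᵥ v e) = _
  rw [← hall, htr]
  ring

/-- Markov bound for bad trees. -/
lemma bad_bound {k : ℕ} (G : SimpleGraph (Fin (k+1+1))) (hG : G.Connected) (R : ℝ)
    (hlev : ∀ e ∈ G.edgeSet, lev (k+1+1) G 1 e ≤ R) :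
    0 < R ∧ ∃ κ : ℝ, 0 ≤ κ ∧
      κ * ((univ.filter (fun T => IsSpanningTree (k+1+1) G T)).card : ℝ) = 1 ∧
      ∀ τ : ℝ, 0 ≤ τ → ∀ p : ℕ,
      κ * ((univ.filter (fun T => IsSpanningTree (k+1+1) G T ∧
        ¬ (τ • lap (k+1+1) G 1 - ∑ e ∈ T, edgeMat (k+1+1) e).PosSemidef)).card : ℝ) * τ ^ p ≤
      ((k+1 : ℕ) : ℝ) * ((k+1 : ℕ) + 1) * ((k+1 : ℕ) + 2) / 2 * (p.factorial * R ^ p) := by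
  obtain ⟨X, Y, hYdet, hYX, hXY, hv⟩ := exists_iso G hG
  set v := fun e => Y *ᵥ bb ℝ G e with hvdef
  have hv' : ∑ e, vecMulVec (v e) (v e) = 1 := hv
  have hnorm : ∀ e, v e ⬝ᵥ v e = lev (k+1+1) G 1 e := lev_eq G Y hv
  have hnot : ∀ e, e ∉ G.edgeSet → v e = 0 := by
    intro e he
    simp [hvdef, bb_notMem G e he]
  have hRpos : 0 < R := by
    by_contra! hR
    have hs := sum_norm v hv'
    have : ∑ e, v e ⬝ᵥ v e ≤ 0 := by
      refine Finset.sum_nonpos fun e _ => ?_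
      by_cases he : e ∈ G.edgeSet
      · rw [hnorm]; exact (hlev e he).trans hR
      · simp [hnot e he]
    rw [hs] at this
    simp at this
    have : (0:ℝ) ≤ k := Nat.cast_nonneg k
    linarith
  have hvR : ∀ e, v e ⬝ᵥ v e ≤ R := by
    intro e
    by_cases he : e ∈ G.edgeSet
    · rw [hnorm]; exact hlev e he
    · simp [hnot e he, hRpos.le]
  refine ⟨hRpos, Y.det ^ 2, sq_nonneg _, total G Y hv, ?_⟩
  intro τ hτ p
  have hmom := moment v hv' R hRpos.le hvR (k+1) (by simp) p
  simp only [Fintype.card_fin] at hmom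
  rw [H_final] at hmom
  let bad : Finset (Sym2 (Fin (k+1+1))) → Prop := fun T =>
    ¬ (τ • lap (k+1+1) G 1 - ∑ e ∈ T, edgeMat (k+1+1) e).PosSemidef
  have htr := transfer G Y (fun T => if bad T then τ ^ p else 0)
  have hle : ∑ s : Fin (k+1) → Sym2 (Fin (k+1+1)), gr v s * (if bad (univ.image s) then τ ^ p else 0) ≤
      ∑ s : Fin (k+1) → Sym2 (Fin (k+1+1)), gr v s * ((mat v s) ^ p).trace := by
    refine Finset.sum_le_sum fun s _ => ?_
    by_cases hT : IsSpanningTree (k+1+1) G (univ.image s)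
    swap
    · have : gr v s = 0 := by rw [hvdef, gr_eq]; simp [hT]
      simp [this]
    refine mul_le_mul_of_nonneg_left ?_ (gr_nonneg v s)
    split_ifs with hb
    swap
    · exact trace_pow_nonneg _ (mat_psd v s) p
    have hinj : Function.Injective s := by
      have h1 : (univ.image s).card = (univ : Finset (Fin (k+1))).card := by rw [hT.2.2]; simp
      have := Finset.card_image_iff.1 h1
      simpa using this
    have hherm_e : ∀ e : Sym2 (Fin (k+1+1)), (edgeMat (k+1+1) e).IsHermitian := by
      intro e
      ext i j
      simp only [conjTranspose_apply, edgeMat, star_trivial]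
      grind
    have hherm : (τ • lap (k+1+1) G 1 - ∑ e ∈ univ.image s, edgeMat (k+1+1) e).IsHermitian := by
      have h1 : (lap (k+1+1) G 1)ᴴ = lap (k+1+1) G 1 := by
        unfold lap
        rw [conjTranspose_sum]
        refine Finset.sum_congr rfl fun e _ => ?_
        rw [conjTranspose_smul, hherm_e e]
        simp
      rw [IsHermitian, conjTranspose_sub, conjTranspose_smul, h1, conjTranspose_sum]
      congr 1
      exact Finset.sum_congr rfl fun e _ => hherm_e e
    have hex : ∃ x : Fin (k+1+1) → ℝ,
        x ⬝ᵥ ((τ • lap (k+1+1) G 1 - ∑ e ∈ univ.image s, edgeMat (k+1+1) e) *ᵥ x) < 0 := by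
      by_contra! hcon
      exact hb (PosSemidef.of_dotProduct_mulVec_nonneg hherm (by simpa using hcon))
    obtain ⟨x, hx⟩ := hex
    have hvy : ∀ e, v e ⬝ᵥ (X *ᵥ fun i => x i.succ - x 0) = bb ℝ G e ⬝ᵥ fun i => x i.succ - x 0 := by
      intro e
      rw [dotProduct_mulVec, ← mulVec_transpose, hvdef, mulVec_mulVec, hXY, one_mulVec]
    set y := X *ᵥ fun i => x i.succ - x 0
    have hvm : ∀ e, y ⬝ᵥ (vecMulVec (v e) (v e) *ᵥ y) = (v e ⬝ᵥ y) ^ 2 := by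
      intro e
      rw [vecMulVec_mulVec]
      simp [dotProduct_comm, sq]
    refine markov_trace _ (mat_psd v s) τ hτ y ?_ p
    rw [Matrix.sub_mulVec, dotProduct_sub, Matrix.smul_mulVec, dotProduct_smul, lap_quad] at hx
    have hyy : y ⬝ᵥ y = ∑ e, (bb ℝ G e ⬝ᵥ fun i => x i.succ - x 0) ^ 2 := by
      have : y ⬝ᵥ y = y ⬝ᵥ ((∑ e, vecMulVec (v e) (v e)) *ᵥ y) := by rw [hv', one_mulVec]
      rw [this, Matrix.sum_mulVec, dotProduct_sum]
      exact Finset.sum_congr rfl fun e _ => by rw [hvm, hvy]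
    have hyM : y ⬝ᵥ (mat v s *ᵥ y) = x ⬝ᵥ ((∑ e ∈ univ.image s, edgeMat (k+1+1) e) *ᵥ x) := by
      rw [mat, Matrix.sum_mulVec, dotProduct_sum, Matrix.sum_mulVec, dotProduct_sum,
        Finset.sum_image (fun a _ b _ h => hinj h)]
      refine Finset.sum_congr rfl fun i _ => ?_
      have hi : s i ∈ G.edgeSet := hT.1 (by simp)
      rw [hvm, hvy, bb_dot G _ hi, edge_quad G _ hi]
    rw [hyy, hyM]
    simp only [smul_eq_mul] at hx
    linarith
  have hfin := hle.trans hmom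
  change ∑ s : Fin (k+1) → Sym2 (Fin (k+1+1)), gr v s * (if bad (univ.image s) then τ ^ p else 0) = _ at htr
  rw [htr, ← Finset.sum_filter, Finset.filter_filter, Finset.sum_const, nsmul_eq_mul] at hfin
  have hf : (0:ℝ) < ((k+1).factorial : ℝ) := by positivity
  refine le_of_mul_le_mul_left ?_ hf
  calc _ = Y.det ^ 2 * ((k+1).factorial : ℝ) * (((univ.filter (fun T => IsSpanningTree (k+1+1) G T ∧
        bad T)).card : ℝ) * τ ^ p) := by ring
    _ ≤ _ := hfin
    _ = _ := by ring

lemma numeric (n : ℕ) (hn : 2 ≤ n) : ∃ p : ℕ,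
    ((n : ℝ)) ^ 4 * p.factorial ≤ (3 * Real.exp 4 * Real.log n) ^ p := by
  have hn' : (2:ℝ) ≤ n := by exact_mod_cast hn
  have hl : Real.log 2 ≤ Real.log n := Real.log_le_log (by norm_num) hn'
  have hl2 := Real.log_two_gt_d9
  refine ⟨⌈Real.log n⌉₊, ?_⟩
  set l := Real.log n with hldef
  set p := ⌈l⌉₊ with hp
  have h1 : l ≤ p := Nat.le_ceil l
  have h2 : (p:ℝ) < l + 1 := Nat.ceil_lt_add_one (by linarith)
  have h3 : (p:ℝ) ≤ 3 * l := by linarith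
  have h4 : (p.factorial : ℝ) ≤ (3 * l) ^ p := by
    calc (p.factorial : ℝ) ≤ (p:ℝ) ^ p := by exact_mod_cast Nat.factorial_le_pow p
      _ ≤ _ := pow_le_pow_left₀ (by positivity) h3 p
  have h5 : (n:ℝ) ^ 4 ≤ Real.exp 4 ^ p := by
    have : (n:ℝ) = Real.exp l := (Real.exp_log (by linarith)).symm
    rw [this, ← Real.exp_nat_mul, ← Real.exp_nat_mul]
    apply Real.exp_le_exp.2
    push_cast
    linarith
  have e : (3 * Real.exp 4 * l) ^ p = Real.exp 4 ^ p * (3 * l) ^ p := by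
    rw [← mul_pow]; ring
  rw [e]
  exact mul_le_mul h5 h4 (by positivity) (by positivity)

end RST

/-- a uniform random spanning tree of a graph whose edges all have leverage
score at most ε̄ is O(ε̄ ln n)-spectrally thin with high probability. -/
theorem random_tree_spectrally_thin :
    ∃ C > (0:ℝ), ∃ c > (0:ℝ), ∀ n : ℕ, 2 ≤ n →
    ∀ G : SimpleGraph (Fin n), G.Connected →
    ∀ εbar : ℝ, (∀ e ∈ G.edgeSet, lev n G 1 e ≤ εbar) →
    1 - (n : ℝ) ^ (-c) ≤
      ∑ T ∈ Finset.univ.filter (fun T : Finset (Sym2 (Fin n)) =>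
        ((C * εbar * Real.log n) • lap n G 1 - ∑ e ∈ T, edgeMat n e).PosSemidef),
        treeProb n G 1 T := by
  refine ⟨3 * Real.exp 4, by positivity, 1, one_pos, ?_⟩
  intro n hn G hG ε hε
  obtain ⟨k, rfl⟩ : ∃ k, n = k + 1 + 1 := ⟨n - 2, by omega⟩
  obtain ⟨hR, κ, hκ, htot, hbad⟩ := RST.bad_bound G hG ε hε
  obtain ⟨p, hp⟩ := RST.numeric (k+1+1) hn
  have hn' : (2:ℝ) ≤ ((k+1+1 : ℕ) : ℝ) := by exact_mod_cast hn
  have hlog : 0 < Real.log ((k+1+1 : ℕ) : ℝ) := Real.log_pos (by linarith)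
  set l := Real.log ((k+1+1 : ℕ) : ℝ) with hl
  set N : ℝ := ((univ.filter (fun T => IsSpanningTree (k+1+1) G T)).card : ℝ) with hN
  have hN0 : N ≠ 0 := by intro h; rw [h] at htot; simp at htot
  have hκN : κ = 1 / N := by field_simp; exact htot
  have hb := hbad (3 * Real.exp 4 * ε * l) (by positivity) p
  set good : Finset (Sym2 (Fin (k+1+1))) → Prop := fun T =>
    ((3 * Real.exp 4 * ε * l) • lap (k+1+1) G 1 - ∑ e ∈ T, edgeMat (k+1+1) e).PosSemidef with hgood
  set β : ℝ := ((univ.filter (fun T => IsSpanningTree (k+1+1) G T ∧ ¬ good T)).card : ℝ) with hβ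
  have hsum : ∑ T ∈ univ.filter good, treeProb (k+1+1) G 1 T = 1 - κ * β := by
    simp_rw [RST.treeProb_eq]
    rw [← Finset.sum_div, Finset.sum_boole, Finset.filter_filter, hκN]
    have hcard : N = ((univ.filter (fun T => good T ∧ IsSpanningTree (k+1+1) G T)).card : ℝ) + β := by
      rw [hN, hβ, ← Finset.card_filter_add_card_filter_not (s := univ.filter (fun T =>
        IsSpanningTree (k+1+1) G T)) good, Finset.filter_filter, Finset.filter_filter]
      push_cast
      congr 3
      ext T
      simp [and_comm]
    rw [← hN]
    field_simp
    linarith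
  rw [hsum]
  have e1 : (3 * Real.exp 4 * ε * l) ^ p = (3 * Real.exp 4 * l) ^ p * ε ^ p := by
    rw [← mul_pow]; ring
  rw [e1] at hb
  have hεp : 0 < ε ^ p := pow_pos hR p
  have hpf : (0:ℝ) < p.factorial := by positivity
  set x : ℝ := ((k+1+1 : ℕ) : ℝ) with hx
  have hxk : ((k+1 : ℕ) : ℝ) = x - 1 := by rw [hx]; push_cast; ring
  have hκβ : 0 ≤ κ * β := mul_nonneg hκ (by positivity)
  have h1 : κ * β * (x ^ 4 * p.factorial) * ε ^ p ≤ x ^ 3 * p.factorial * ε ^ p := by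
    calc κ * β * (x ^ 4 * p.factorial) * ε ^ p ≤ κ * β * (3 * Real.exp 4 * l) ^ p * ε ^ p :=
          mul_le_mul_of_nonneg_right (mul_le_mul_of_nonneg_left hp hκβ) hεp.le
      _ = κ * β * ((3 * Real.exp 4 * l) ^ p * ε ^ p) := by ring
      _ ≤ _ := hb
      _ ≤ x ^ 3 * (p.factorial * ε ^ p) := by
          refine mul_le_mul_of_nonneg_right ?_ (by positivity)
          rw [hxk]
          nlinarith [pow_pos (by linarith : (0:ℝ) < x) 3]
      _ = _ := by ring
  have h2 : κ * β * x ≤ 1 := by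
    have hc : 0 < x ^ 3 * p.factorial * ε ^ p := by positivity
    refine le_of_mul_le_mul_left ?_ hc
    linarith
  have h3 : κ * β ≤ x⁻¹ := by
    rw [← one_div, le_div_iff₀ (by linarith)]
    exact h2
  rw [Real.rpow_neg_one]
  linarith

end
end

section
/- Let (Ω, P) be a finite probability space, let R > 0, and let Y, U : Ω → ℝ^{n×n} be random matrices whose values are real symmetric positive semidefinite matrices with spectral norm at most R, and suppose E[U] = E[Y]. Then E[(Y − U)²] ⪯ 4R·E[Y]. -/
open Matrix Finset
attribute [local instance] Classical.propDecidable

noncomputable section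

/-- The quadratic form is bounded by the spectral norm. -/
theorem quad_le_of_specNorm {n : ℕ} (A : Matrix (Fin n) (Fin n) ℝ) (R : ℝ)
    (hA : specNorm A ≤ R) (x : Fin n → ℝ) : x ⬝ᵥ A.mulVec x ≤ R * (x ⬝ᵥ x) := by
  have hbdd : BddAbove { r | ∃ x : Fin n → ℝ, x ⬝ᵥ x = 1 ∧ |x ⬝ᵥ A.mulVec x| = r } := by
    refine ⟨∑ i, ∑ j, |A i j|, ?_⟩
    rintro r ⟨y, hy, rfl⟩
    have hy1 : ∀ i, |y i| ≤ 1 := by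
      intro i
      have h1 : y i * y i ≤ ∑ j, y j * y j :=
        Finset.single_le_sum (f := fun j => y j * y j)
          (fun j _ => mul_self_nonneg (y j)) (Finset.mem_univ i)
      have h2 : ∑ j, y j * y j = 1 := hy
      rw [abs_le]
      constructor <;> nlinarith
    simp only [dotProduct, Matrix.mulVec]
    refine (Finset.abs_sum_le_sum_abs _ _).trans (Finset.sum_le_sum fun i _ => ?_)
    rw [abs_mul]
    have h3 : |∑ j, A i j * y j| ≤ ∑ j, |A i j| := by
      refine (Finset.abs_sum_le_sum_abs _ _).trans (Finset.sum_le_sum fun j _ => ?_)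
      rw [abs_mul]
      exact mul_le_of_le_one_right (abs_nonneg _) (hy1 j)
    exact (mul_le_of_le_one_left (abs_nonneg _) (hy1 i)).trans h3
  by_cases hx : x = 0
  · simp [hx]
  have h0 : 0 ≤ x ⬝ᵥ x := Finset.sum_nonneg fun i _ => mul_self_nonneg (x i)
  have hpos : 0 < x ⬝ᵥ x := lt_of_le_of_ne h0 fun h => hx (dotProduct_self_eq_zero.mp h.symm)
  set c := Real.sqrt (x ⬝ᵥ x) with hc
  have hcpos : 0 < c := Real.sqrt_pos.mpr hpos
  have hcc : c * c = x ⬝ᵥ x := Real.mul_self_sqrt h0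
  have hunit : (c⁻¹ • x) ⬝ᵥ (c⁻¹ • x) = 1 := by
    rw [smul_dotProduct, dotProduct_smul, ← hcc]
    simp only [smul_eq_mul]
    field_simp
  have hle : |(c⁻¹ • x) ⬝ᵥ A.mulVec (c⁻¹ • x)| ≤ R :=
    (le_csSup hbdd ⟨_, hunit, rfl⟩).trans hA
  have hle2 := (le_abs_self _).trans hle
  rw [Matrix.mulVec_smul, smul_dotProduct, dotProduct_smul] at hle2
  simp only [smul_eq_mul] at hle2
  rw [← hcc]
  have h4 := mul_le_mul_of_nonneg_left hle2 (mul_pos hcpos hcpos).le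
  have h5 : c * c * (c⁻¹ * (c⁻¹ * (x ⬝ᵥ A.mulVec x))) = x ⬝ᵥ A.mulVec x := by
    field_simp
  linarith

/-- For a positive semidefinite `A` of norm at most `R`, `A² ⪯ R A`. -/
theorem psd_smul_sub_sq {n : ℕ} (A : Matrix (Fin n) (Fin n) ℝ) (R : ℝ) (hR : 0 < R)
    (hp : A.PosSemidef) (hA : specNorm A ≤ R) : (R • A - A ^ 2).PosSemidef := by
  have hAH : Aᴴ = A := hp.1
  have hB : (R • (1 : Matrix (Fin n) (Fin n) ℝ) - A).PosSemidef := by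
    refine Matrix.PosSemidef.of_dotProduct_mulVec_nonneg ?_ ?_
    · simpa [Matrix.IsHermitian] using hAH
    · intro x
      have h := quad_le_of_specNorm A R hA x
      simp only [star_trivial, Matrix.sub_mulVec, Matrix.smul_mulVec, Matrix.one_mulVec,
        dotProduct_sub, dotProduct_smul, smul_eq_mul]
      linarith
  have h1 := hB.conjTranspose_mul_mul_same A
  have h2 := hp.conjTranspose_mul_mul_same (R • (1 : Matrix (Fin n) (Fin n) ℝ) - A)
  have hBH : (R • (1 : Matrix (Fin n) (Fin n) ℝ) - A)ᴴ = R • 1 - A := hB.1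
  rw [hAH] at h1
  rw [hBH] at h2
  have h3 := (h1.add h2).smul (inv_pos.mpr hR).le
  have h4 : R • A - A ^ 2 = R⁻¹ • (A * (R • (1 : Matrix (Fin n) (Fin n) ℝ) - A) * A +
      (R • (1 : Matrix (Fin n) (Fin n) ℝ) - A) * A * (R • 1 - A)) := by
    rw [eq_inv_smul_iff₀ hR.ne']
    simp only [mul_sub, sub_mul, smul_sub, Matrix.mul_smul, Matrix.smul_mul, mul_one, one_mul,
      pow_two]
    abel
  rw [h4]
  exact h3

/-- variance bound E[(Y-U)²] ⪯ 4R E[Y] for norm-bounded PSD random matrices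
with equal means. -/
theorem matrix_variance_bound {Ω : Type} [Fintype Ω]
    (P : Ω → ℝ) (hP0 : ∀ ω, 0 ≤ P ω) (hP1 : ∑ ω, P ω = 1)
    {n : ℕ} (R : ℝ) (hR : 0 < R)
    (Y U : Ω → Matrix (Fin n) (Fin n) ℝ)
    (hYpsd : ∀ ω, (Y ω).PosSemidef) (hUpsd : ∀ ω, (U ω).PosSemidef)
    (hYn : ∀ ω, specNorm (Y ω) ≤ R) (hUn : ∀ ω, specNorm (U ω) ≤ R)
    (hmean : ∑ ω, P ω • U ω = ∑ ω, P ω • Y ω) :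
    ((4 * R) • ∑ ω, P ω • Y ω - ∑ ω, P ω • (Y ω - U ω) ^ 2).PosSemidef := by
  have key : (4 * R) • ∑ ω, P ω • Y ω - ∑ ω, P ω • (Y ω - U ω) ^ 2 =
      ∑ ω, P ω • ((2 : ℝ) • (R • Y ω - Y ω ^ 2) + (2 : ℝ) • (R • U ω - U ω ^ 2) +
        (Y ω + U ω) ^ 2) := by
    have h1 : (4 * R) • ∑ ω, P ω • Y ω =
        (2 * R) • ∑ ω, P ω • Y ω + (2 * R) • ∑ ω, P ω • U ω := by
      rw [hmean, ← add_smul]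
      congr 1
      ring
    rw [h1, Finset.smul_sum, Finset.smul_sum, ← Finset.sum_add_distrib,
      ← Finset.sum_sub_distrib]
    refine Finset.sum_congr rfl fun ω _ => ?_
    simp only [pow_two, mul_sub, sub_mul, mul_add, add_mul]
    module
  rw [key]
  refine Matrix.posSemidef_sum _ fun ω _ => ?_
  refine Matrix.PosSemidef.smul ?_ (hP0 ω)
  refine ((Matrix.PosSemidef.smul (psd_smul_sub_sq _ R hR (hYpsd ω) (hYn ω)) zero_le_two).add
    (Matrix.PosSemidef.smul (psd_smul_sub_sq _ R hR (hUpsd ω) (hUn ω)) zero_le_two)).add ?_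
  have h := Matrix.posSemidef_conjTranspose_mul_self (Y ω + U ω)
  have hH : (Y ω + U ω)ᴴ = Y ω + U ω := ((hYpsd ω).add (hUpsd ω)).1
  rw [hH] at h
  rwa [pow_two]

end
end

section
/- For every p ∈ (0, 1/2] and every δ ∈ (0, 1), it holds that (1 − δ)·(1 + δp/(1−p))^{1/((1−δ)p) − 1} ≤ exp( 2δ²/(1−δ) ). -/
open Matrix Finset
attribute [local instance] Classical.propDecidable

noncomputable section

/-- the elementary real inequality from the reverse Chernoff proof. -/
theorem elementary_exp_inequality (p δ : ℝ) (hp1 : 0 < p) (hp2 : p ≤ 1 / 2)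
    (hδ1 : 0 < δ) (hδ2 : δ < 1) :
    (1 - δ) * (1 + δ * p / (1 - p)) ^ (1 / ((1 - δ) * p) - 1) ≤
      Real.exp (2 * δ ^ 2 / (1 - δ)) := by
  have h1p : 0 < 1 - p := by linarith
  have h1d : 0 < 1 - δ := by linarith
  have hx : 0 < δ * p / (1 - p) := by positivity
  have hq : p / (1 - p) ≤ 1 := by rw [div_le_one h1p]; linarith
  have he : 0 ≤ 1 / ((1 - δ) * p) - 1 := by
    rw [sub_nonneg, le_div_iff₀ (by positivity)]
    nlinarith
  have h1 : 1 - δ ≤ Real.exp (-δ) := by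
    have := Real.add_one_le_exp (-δ)
    linarith
  have h2 : (1 + δ * p / (1 - p)) ^ (1 / ((1 - δ) * p) - 1) ≤
      Real.exp (δ * p / (1 - p) * (1 / ((1 - δ) * p) - 1)) := by
    rw [Real.exp_mul]
    refine Real.rpow_le_rpow (by positivity) ?_ he
    have := Real.add_one_le_exp (δ * p / (1 - p))
    linarith
  have h3 : δ * p / (1 - p) * (1 / ((1 - δ) * p) - 1) =
      δ / (1 - δ) * (1 + δ * (p / (1 - p))) := by
    field_simp
    ring
  have h4 : δ / (1 - δ) * (1 + δ * (p / (1 - p))) ≤ δ / (1 - δ) * (1 + δ * 1) := by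
    gcongr
  have h5 : -δ + δ / (1 - δ) * (1 + δ * 1) = 2 * δ ^ 2 / (1 - δ) := by
    field_simp
    ring
  calc _ ≤ Real.exp (-δ) * Real.exp (δ * p / (1 - p) * (1 / ((1 - δ) * p) - 1)) := by
        gcongr
    _ = Real.exp (-δ + δ * p / (1 - p) * (1 / ((1 - δ) * p) - 1)) := by rw [Real.exp_add]
    _ ≤ _ := by
        apply Real.exp_le_exp.mpr
        rw [h3]
        linarith

end
end
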